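/- arXiv:0905.2286 — 5 statements merged into one kernel-verified Lean document; each statement's English description precedes it below -/
import Mathlib

section
/- Let n ≥ 1 be an integer. Let S be the finite set of vectors (m_0, m_1, …, m_{n-1}) in (ℤ_{≥0})^n satisfying Σ_{i=0}^{n-1} m_i = n and Σ_{i=0}^{n-1} i·m_i ≡ 0 (mod n). Let M be the additive sub-semigroup of ℤ^n generated by S, and let N be the subgroup of ℤ^n generated by M. Then M = { x ∈ N : q·x ∈ M for some positive integer q }; that is, M is a normal (saturated in N) semigroup. -/
/-- Erdős–Ginzburg–Ziv for vectors of multiplicities. -/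
theorem exists_le_sum_eq_dvd_weighted_sum {n : ℕ} (x : Fin n → ℤ) (hx : ∀ i, 0 ≤ x i)
    (hsum : 2 * (n : ℤ) - 1 ≤ ∑ i, x i) :
    ∃ m : Fin n → ℤ, (∀ i, 0 ≤ m i) ∧ (∀ i, m i ≤ x i) ∧ ∑ i, m i = (n : ℤ) ∧
      (n : ℤ) ∣ ∑ i : Fin n, (i : ℤ) * m i := by
  classical
  let s : Finset (Σ _ : Fin n, ℕ) := Finset.univ.sigma fun i => Finset.range (x i).toNat
  have hs : (s.card : ℤ) = ∑ i, x i := by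
    simp [s, Finset.card_sigma, hx]
  obtain ⟨t, hts, htn, hdvd⟩ := Int.erdos_ginzburg_ziv (s := s) (n := n)
    (fun p => ((p.1 : ℕ) : ℤ)) (by omega)
  refine ⟨fun i => ((t.filter fun p => p.1 = i).card : ℤ), fun i => by positivity, fun i => ?_,
    ?_, ?_⟩
  · have hsub : (t.filter fun p => p.1 = i) ⊆
        (Finset.range (x i).toNat).map (Function.Embedding.sigmaMk i) := by
      rintro ⟨j, a⟩ hp
      obtain ⟨hpt, rfl : j = i⟩ := Finset.mem_filter.mp hp
      simpa [s] using hts hpt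
    have := Finset.card_le_card hsub
    have := hx i
    simp only [Finset.card_map, Finset.card_range] at *
    omega
  · have hfib := Finset.card_eq_sum_card_fiberwise (s := t) (f := Sigma.fst) (t := Finset.univ)
      (by simp)
    rw [htn] at hfib
    beta_reduce
    exact_mod_cast hfib.symm
  · convert hdvd using 1
    rw [← Finset.sum_fiberwise t (fun p => p.1)]
    refine Finset.sum_congr rfl fun i _ => ?_
    rw [Finset.sum_congr rfl (g := fun _ => (i : ℤ))
      fun p hp => by rw [(Finset.mem_filter.mp hp).2]]
    simp [mul_comm]

/-- A nonnegative vector with coordinate sum `k * n` and weighted sum divisible by `n` is a sum of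
such vectors with coordinate sum `n`. -/
theorem mem_closure_of_sum_eq_mul {n : ℕ} (k : ℕ) (x : Fin n → ℤ)
    (hx : ∀ i, 0 ≤ x i) (hsum : ∑ i, x i = k * (n : ℤ))
    (hdvd : (n : ℤ) ∣ ∑ i : Fin n, (i : ℤ) * x i) :
    x ∈ AddSubmonoid.closure {m : Fin n → ℤ | (∀ i, 0 ≤ m i) ∧ (∑ i, m i) = (n : ℤ) ∧
      (n : ℤ) ∣ ∑ i : Fin n, (i : ℤ) * m i} := by
  induction k generalizing x with
  | zero =>
    have h0 : x = 0 := by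
      ext i
      exact (Finset.sum_eq_zero_iff_of_nonneg fun i _ => hx i).mp (by simpa using hsum) i
        (Finset.mem_univ i)
    exact h0 ▸ zero_mem _
  | succ k ih =>
    rcases Nat.eq_zero_or_pos k with rfl | hk
    · exact AddSubmonoid.subset_closure ⟨hx, by simpa using hsum, hdvd⟩
    · obtain ⟨m, hm0, hmx, hmsum, hmdvd⟩ := exists_le_sum_eq_dvd_weighted_sum x hx (by
        have : (1 : ℤ) ≤ k := by exact_mod_cast hk
        rw [hsum]
        push_cast
        nlinarith [Int.natCast_nonneg n])
      rw [← sub_add_cancel x m]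
      refine add_mem (ih (x - m) (fun i => sub_nonneg.mpr (hmx i)) ?_ ?_)
        (AddSubmonoid.subset_closure ⟨hm0, hmsum, hmdvd⟩)
      · simp only [Pi.sub_apply, Finset.sum_sub_distrib, hsum, hmsum]
        push_cast
        ring
      · simp only [Pi.sub_apply, mul_sub, Finset.sum_sub_distrib]
        exact dvd_sub hdvd hmdvd


/-- The sub-semigroup `M` of `ℤⁿ` generated by the set `S` of nonnegative
vectors with coordinate sum `n` and weighted sum `Σ i·mᵢ ≡ 0 (mod n)` is saturated (normal)
in the subgroup `N` of `ℤⁿ` generated by `M`. -/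
theorem semigroup_M_is_normal (n : ℕ) (hn : 1 ≤ n)
    (S : Set (Fin n → ℤ))
    (hS : S = {m : Fin n → ℤ | (∀ i, 0 ≤ m i) ∧ (∑ i, m i) = (n : ℤ) ∧
      (n : ℤ) ∣ ∑ i : Fin n, (i : ℤ) * m i})
    (M : AddSubmonoid (Fin n → ℤ)) (hM : M = AddSubmonoid.closure S)
    (N : AddSubgroup (Fin n → ℤ)) (hN : N = AddSubgroup.closure (M : Set (Fin n → ℤ))) :
    (M : Set (Fin n → ℤ)) = {x : Fin n → ℤ | x ∈ N ∧ ∃ q : ℕ, 0 < q ∧ q • x ∈ M} := by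
  subst hS hM hN
  ext x
  refine ⟨fun h => ⟨AddSubgroup.subset_closure h, 1, one_pos, by simpa using h⟩, ?_⟩
  rintro ⟨hN, q, hq, hqx⟩
  have hx : ∀ i, 0 ≤ x i := by
    have hnonneg : 0 ≤ q • x := by
      generalize q • x = y at hqx
      induction hqx using AddSubmonoid.closure_induction with
      | mem y hy => exact hy.1
      | zero => exact le_rfl
      | add y z _ _ hy hz => exact add_nonneg hy hz
    intro i
    have hi := hnonneg i
    simp only [Pi.zero_apply, Pi.smul_apply, nsmul_eq_mul] at hi
    exact nonneg_of_mul_nonneg_right hi (by exact_mod_cast hq)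
  have hdvd : (n : ℤ) ∣ ∑ i, x i ∧ (n : ℤ) ∣ ∑ i : Fin n, (i : ℤ) * x i := by
    replace hN := (AddSubgroup.closure_le _).mpr
      (AddSubmonoid.closure_le (S := (AddSubgroup.closure _).toAddSubmonoid).mpr
        AddSubgroup.subset_closure) hN
    clear hqx hx
    induction hN using AddSubgroup.closure_induction with
    | mem y hy => exact ⟨hy.2.1 ▸ dvd_rfl, hy.2.2⟩
    | zero => simp
    | add y z _ _ hy hz =>
      simp only [Pi.add_apply, mul_add, Finset.sum_add_distrib]
      exact ⟨dvd_add hy.1 hz.1, dvd_add hy.2 hz.2⟩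
    | neg y _ hy => simpa using hy
  obtain ⟨⟨c, hc⟩, hw⟩ := hdvd
  have hn' : (0 : ℤ) < n := by exact_mod_cast hn
  have hc0 : 0 ≤ c :=
    nonneg_of_mul_nonneg_right (hc ▸ Finset.sum_nonneg fun i _ => hx i) hn'
  lift c to ℕ using hc0
  exact mem_closure_of_sum_eq_mul c x hx (by rw [hc, mul_comm]) hw
end

section
/- Let n ≥ 1 be an integer. Define the group homomorphism Φ : ℤ^n → ℤ/nℤ ⊕ ℤ/nℤ by Φ(x_0, x_1, …, x_{n-1}) = (Σ_{i=0}^{n-1} x_i mod n, Σ_{i=0}^{n-1} i·x_i mod n). Let S be the set of vectors (m_0, …, m_{n-1}) in (ℤ_{≥0})^n with Σ_{i=0}^{n-1} m_i = n and Σ_{i=0}^{n-1} i·m_i ≡ 0 (mod n), and let N be the subgroup of ℤ^n generated by S. Then N = Ker(Φ). -/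
/-- The nonnegative vectors in `ℤⁿ` with coordinate sum `n` and weighted sum divisible by `n`. -/
def zeroSumVectors (n : ℕ) : Set (Fin n → ℤ) :=
  {m | (∀ i, 0 ≤ m i) ∧ (∑ i, m i) = (n : ℤ) ∧ (n : ℤ) ∣ ∑ i : Fin n, (i : ℤ) * m i}

theorem nsmul_single_mem_zeroSumVectors {n : ℕ} (i : Fin n) :
    n • (Pi.single i 1 : Fin n → ℤ) ∈ zeroSumVectors n := by
  refine ⟨fun j => ?_, ?_, ?_⟩
  · by_cases h : j = i <;> simp [h]
  · simp [Pi.single_apply]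
  · simp [Pi.single_apply]

theorem single_add_single_add_single_mem_zeroSumVectors {n : ℕ} [NeZero n] (hn : 3 ≤ n)
    (i j k : Fin n) (h : n ∣ (i : ℕ) + j + k) :
    (Pi.single i 1 + Pi.single j 1 + Pi.single k 1 + (n - 3) • Pi.single 0 1 : Fin n → ℤ) ∈
      zeroSumVectors n := by
  refine ⟨?_, ?_, ?_⟩
  · have single_nonneg (a : Fin n) : (0 : Fin n → ℤ) ≤ Pi.single a 1 :=
      Pi.single_nonneg.2 zero_le_one
    exact add_nonneg (add_nonneg (add_nonneg (single_nonneg i) (single_nonneg j))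
      (single_nonneg k)) (nsmul_nonneg (single_nonneg 0) _)
  · simp [Pi.single_apply, Finset.sum_add_distrib]
    omega
  · simp [Pi.single_apply, Finset.sum_add_distrib, mul_add]
    exact_mod_cast h

/-- Modulo the generated subgroup, `e_k - e_0` is additive in the index `k`. -/
theorem single_sub_single_zero_sub_nsmul_mem_closure {n : ℕ} [NeZero n] (k : ℕ) (hk : k < n) :
    (Pi.single (Fin.ofNat n k) 1 - Pi.single 0 1
        - k • (Pi.single (Fin.ofNat n 1) 1 - Pi.single 0 1) : Fin n → ℤ) ∈
      AddSubgroup.closure (zeroSumVectors n) := by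
  induction k with
  | zero => simp
  | succ k ih =>
    rcases Nat.eq_zero_or_pos k with rfl | hpos
    · simp
    have hn : 3 ≤ n := by omega
    have h₁ := AddSubgroup.subset_closure
      (single_add_single_add_single_mem_zeroSumVectors hn (Fin.ofNat n k) (Fin.ofNat n 1)
        (Fin.ofNat n (n - (k + 1))) (by
          simp only [Fin.val_ofNat]
          rw [Nat.mod_eq_of_lt (by omega), Nat.mod_eq_of_lt (by omega),
            Nat.mod_eq_of_lt (by omega)]
          exact ⟨1, by omega⟩))
    have h₂ := AddSubgroup.subset_closure
      (single_add_single_add_single_mem_zeroSumVectors hn (Fin.ofNat n (k + 1)) 0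
        (Fin.ofNat n (n - (k + 1))) (by
          simp only [Fin.val_ofNat, Fin.val_zero]
          rw [Nat.mod_eq_of_lt hk, Nat.mod_eq_of_lt (by omega)]
          exact ⟨1, by omega⟩))
    convert sub_mem (ih (by omega)) (sub_mem h₁ h₂) using 1
    rw [succ_nsmul]
    abel

/-- The subgroup `N` of `ℤⁿ` generated by the set `S` of nonnegative vectors
with coordinate sum `n` and weighted sum `≡ 0 (mod n)` equals the kernel of the
homomorphism `Φ : ℤⁿ → ℤ/nℤ ⊕ ℤ/nℤ`, `Φ(x) = (Σ xᵢ mod n, Σ i·xᵢ mod n)`. -/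
theorem subgroup_N_eq_ker_Phi (n : ℕ) (hn : 1 ≤ n)
    (Φ : (Fin n → ℤ) →+ ZMod n × ZMod n)
    (hΦ : ∀ x : Fin n → ℤ,
      Φ x = (∑ i : Fin n, (x i : ZMod n), ∑ i : Fin n, (i : ZMod n) * (x i : ZMod n)))
    (S : Set (Fin n → ℤ))
    (hS : S = {m : Fin n → ℤ | (∀ i, 0 ≤ m i) ∧ (∑ i, m i) = (n : ℤ) ∧
      (n : ℤ) ∣ ∑ i : Fin n, (i : ℤ) * m i}) :
    AddSubgroup.closure S = Φ.ker := by
  have : NeZero n := ⟨by omega⟩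
  change S = zeroSumVectors n at hS
  subst hS
  apply le_antisymm
  · rw [AddSubgroup.closure_le]
    rintro m ⟨-, hsum, hdvd⟩
    rw [SetLike.mem_coe, AddMonoidHom.mem_ker, hΦ, Prod.mk_eq_zero]
    constructor
    · rw [← Int.cast_sum, hsum]
      simp
    · simpa using (ZMod.intCast_zmod_eq_zero_iff_dvd _ n).2 hdvd
  · intro x hx
    rw [AddMonoidHom.mem_ker, hΦ, Prod.mk_eq_zero] at hx
    obtain ⟨a, ha⟩ : (n : ℤ) ∣ ∑ i, x i := by
      rw [← ZMod.intCast_zmod_eq_zero_iff_dvd]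
      simpa using hx.1
    obtain ⟨b, hb⟩ : (n : ℤ) ∣ ∑ i : Fin n, (i : ℤ) * x i := by
      rw [← ZMod.intCast_zmod_eq_zero_iff_dvd]
      simpa using hx.2
    set e : Fin n → Fin n → ℤ := fun i => Pi.single i 1
    set d := e (Fin.ofNat n 1) - e 0
    have he (i : Fin n) : n • e i ∈ AddSubgroup.closure (zeroSumVectors n) :=
      AddSubgroup.subset_closure (nsmul_single_mem_zeroSumVectors i)
    have hd : n • d ∈ AddSubgroup.closure (zeroSumVectors n) := by
      rw [nsmul_sub]
      exact sub_mem (he _) (he _)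
    have hlin (i : Fin n) :
        e i - e 0 - (i : ℕ) • d ∈ AddSubgroup.closure (zeroSumVectors n) := by
      have h := single_sub_single_zero_sub_nsmul_mem_closure (i : ℕ) i.isLt
      rwa [Fin.ofNat_val_eq_self] at h
    have hx_eq : x = ∑ i, x i • (e i - e 0 - (i : ℕ) • d) + a • n • e 0 + b • n • d := by
      have hsum : x = ∑ i, x i • e i := by
        ext j
        simp [e, Pi.single_apply]
      have hzero : a • n • e 0 = ∑ i, x i • e 0 := by
        rw [← Finset.sum_smul, ha, mul_comm, mul_smul, natCast_zsmul]
      have hone : b • n • d = ∑ i : Fin n, x i • (i : ℕ) • d := by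
        simp_rw [← natCast_zsmul d, ← mul_smul, ← Finset.sum_smul, mul_comm (x _), hb,
          mul_comm b]
      rw [hzero, hone, ← Finset.sum_add_distrib, ← Finset.sum_add_distrib]
      nth_rw 1 [hsum]
      refine Finset.sum_congr rfl fun i _ => ?_
      rw [smul_sub, smul_sub]
      abel
    rw [hx_eq]
    exact add_mem (add_mem (sum_mem fun i _ => zsmul_mem (hlin i) _) (zsmul_mem (he 0) a))
      (zsmul_mem hd b)
end

section
/- Let n ≥ 2 be an integer, let e_0, …, e_{n-1} be the standard basis of ℤ^n, and define u_{n-2} = n·e_{n-2}, u_{n-1} = n·e_{n-1}, and u_r = e_r + (r+1)·e_{n-2} + (n-r-2)·e_{n-1} for r = 0, 1, …, n-3. Let (m_0, m_1, …, m_{n-1}) ∈ ℤ^n satisfy n ∣ Σ_{i=0}^{n-1} m_i and n ∣ Σ_{i=0}^{n-1} i·m_i. Then (m_0, …, m_{n-1}) = Σ_{i=0}^{n-1} d_i·u_i, where d_i = m_i for i = 0, 1, …, n-3, d_{n-2} = (m_{n-2} − Σ_{i=0}^{n-3} (i+1)·m_i)/n, and d_{n-1} = (m_{n-1} − Σ_{i=0}^{n-3}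 (n-i-2)·m_i)/n; in particular these two last quantities are integers. -/
theorem Fin.sum_univ_eq_sum_filter_add_last_two {M : Type*} [AddCommMonoid M] {n : ℕ}
    {p q : Fin n} (hp : (p : ℕ) + 2 = n) (hq : (q : ℕ) + 1 = n) (f : Fin n → M) :
    ∑ i, f i = ∑ i ∈ Finset.univ.filter (fun i : Fin n => (i : ℕ) + 3 ≤ n), f i
      + f p + f q := by
  have hne : p ≠ q := by
    rw [ne_eq, Fin.ext_iff]
    omega
  have hset : Finset.univ.filter (fun i : Fin n => ¬ (i : ℕ) + 3 ≤ n) = {p, q} := by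
    ext i
    simp only [Finset.mem_filter, Finset.mem_univ, true_and, Finset.mem_insert,
      Finset.mem_singleton, Fin.ext_iff]
    omega
  rw [← Finset.sum_filter_add_sum_filter_not Finset.univ (fun i : Fin n => (i : ℕ) + 3 ≤ n),
    hset, Finset.sum_pair hne, add_assoc]

/-- For `n ≥ 2` and the vectors `u_0, …, u_{n-1}` as in the paper, any
`m ∈ ℤⁿ` with `n ∣ Σ mᵢ` and `n ∣ Σ i·mᵢ` can be written `m = Σ dᵢ·uᵢ`, where `dᵢ = mᵢ`
for `i ≤ n-3`, `d_{n-2} = (m_{n-2} − Σ_{i≤n-3}(i+1)mᵢ)/n` and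
`d_{n-1} = (m_{n-1} − Σ_{i≤n-3}(n-i-2)mᵢ)/n`, these last two quotients being integers. -/
theorem m_is_integral_combination_of_u (n : ℕ) (hn : 2 ≤ n)
    (u : Fin n → Fin n → ℤ)
    (hu2 : u ⟨n - 2, by omega⟩ = (n : ℤ) • Pi.single (⟨n - 2, by omega⟩ : Fin n) (1 : ℤ))
    (hu1 : u ⟨n - 1, by omega⟩ = (n : ℤ) • Pi.single (⟨n - 1, by omega⟩ : Fin n) (1 : ℤ))
    (hur : ∀ r : Fin n, (r : ℕ) + 3 ≤ n →
      u r = Pi.single r (1 : ℤ)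
        + ((r : ℤ) + 1) • Pi.single (⟨n - 2, by omega⟩ : Fin n) (1 : ℤ)
        + ((n : ℤ) - (r : ℤ) - 2) • Pi.single (⟨n - 1, by omega⟩ : Fin n) (1 : ℤ))
    (m : Fin n → ℤ)
    (hm1 : (n : ℤ) ∣ ∑ i, m i)
    (hm2 : (n : ℤ) ∣ ∑ i : Fin n, (i : ℤ) * m i) :
    ∃ d : Fin n → ℤ,
      (∀ i : Fin n, (i : ℕ) + 3 ≤ n → d i = m i) ∧
      (n : ℤ) * d ⟨n - 2, by omega⟩ =
        m ⟨n - 2, by omega⟩ -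
          ∑ i ∈ Finset.univ.filter (fun i : Fin n => (i : ℕ) + 3 ≤ n), ((i : ℤ) + 1) * m i ∧
      (n : ℤ) * d ⟨n - 1, by omega⟩ =
        m ⟨n - 1, by omega⟩ -
          ∑ i ∈ Finset.univ.filter (fun i : Fin n => (i : ℕ) + 3 ≤ n),
            ((n : ℤ) - (i : ℤ) - 2) * m i ∧
      m = ∑ i : Fin n, d i • u i := by
  have split := Fin.sum_univ_eq_sum_filter_add_last_two (M := ℤ)
    (p := ⟨n - 2, by omega⟩) (q := ⟨n - 1, by omega⟩) (Nat.sub_add_cancel hn)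
    (Nat.sub_add_cancel (Nat.le_of_succ_le hn))
  have cast_sub_two : ((n - 2 : ℕ) : ℤ) = n - 2 := by omega
  have cast_sub_one : ((n - 1 : ℕ) : ℤ) = n - 1 := by omega
  have sum_first := split (fun i => ((i : ℤ) + 1) * m i)
  have sum_second := split (fun i => ((n : ℤ) - (i : ℤ) - 2) * m i)
  have expand_first : ∑ i : Fin n, ((i : ℤ) + 1) * m i
      = ∑ i : Fin n, (i : ℤ) * m i + ∑ i, m i := by
    rw [← Finset.sum_add_distrib]
    exact Finset.sum_congr rfl fun i _ => by ring
  have expand_second : ∑ i : Fin n, ((n : ℤ) - (i : ℤ) - 2) * m i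
      = ((n : ℤ) - 2) * ∑ i, m i - ∑ i : Fin n, (i : ℤ) * m i := by
    rw [Finset.mul_sum, ← Finset.sum_sub_distrib]
    exact Finset.sum_congr rfl fun i _ => by ring
  rw [expand_first] at sum_first
  rw [expand_second] at sum_second
  simp only [cast_sub_two, cast_sub_one] at sum_first sum_second
  obtain ⟨s, hs⟩ := hm1
  obtain ⟨t, ht⟩ := hm2
  rw [hs, ht] at sum_first sum_second
  set p : Fin n := ⟨n - 2, by omega⟩ with hp
  set q : Fin n := ⟨n - 1, by omega⟩ with hq
  have hpq : q ≠ p := by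
    simp only [hp, hq, ne_eq, Fin.mk.injEq]
    omega
  set a : ℤ := m p + m q - s - t with ha
  set b : ℤ := t - ((n : ℤ) - 2) * s with hb
  let d : Fin n → ℤ := fun i => if i = p then a else if i = q then b else m i
  have hdp : d p = a := by simp [d]
  have hdq : d q = b := by simp [d, hpq]
  have hd : ∀ i : Fin n, (i : ℕ) + 3 ≤ n → d i = m i := by
    intro i hi
    have hip : i ≠ p := by
      simp only [hp, ne_eq, Fin.ext_iff]
      omega
    have hiq : i ≠ q := by
      simp only [hq, ne_eq, Fin.ext_iff]
      omega
    simp [d, hip, hiq]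
  have na : (n : ℤ) * a = m p -
      ∑ i ∈ Finset.univ.filter (fun i : Fin n => (i : ℕ) + 3 ≤ n), ((i : ℤ) + 1) * m i := by
    rw [ha]
    linear_combination -sum_first
  have nb : (n : ℤ) * b = m q -
      ∑ i ∈ Finset.univ.filter (fun i : Fin n => (i : ℕ) + 3 ≤ n),
        ((n : ℤ) - (i : ℤ) - 2) * m i := by
    rw [hb]
    linear_combination -sum_second
  refine ⟨d, hd, by rw [hdp, na], by rw [hdq, nb], ?_⟩
  ext j
  have expand_m : m j = ∑ i, m i * (Pi.single i (1 : ℤ) : Fin n → ℤ) j := by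
    simp [Pi.single_apply]
  have expand_filter :
      ∑ i ∈ Finset.univ.filter (fun i : Fin n => (i : ℕ) + 3 ≤ n), d i * u i j
      = ∑ i ∈ Finset.univ.filter (fun i : Fin n => (i : ℕ) + 3 ≤ n),
          m i * (Pi.single i (1 : ℤ) : Fin n → ℤ) j
        + (∑ i ∈ Finset.univ.filter (fun i : Fin n => (i : ℕ) + 3 ≤ n), ((i : ℤ) + 1) * m i)
          * (Pi.single p (1 : ℤ) : Fin n → ℤ) j
        + (∑ i ∈ Finset.univ.filter (fun i : Fin n => (i : ℕ) + 3 ≤ n),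
            ((n : ℤ) - (i : ℤ) - 2) * m i) * (Pi.single q (1 : ℤ) : Fin n → ℤ) j := by
    rw [Finset.sum_mul, Finset.sum_mul, ← Finset.sum_add_distrib, ← Finset.sum_add_distrib]
    refine Finset.sum_congr rfl fun i hi => ?_
    have hi' := (Finset.mem_filter.mp hi).2
    rw [hd i hi', hur i hi']
    simp only [Pi.add_apply, Pi.smul_apply, smul_eq_mul]
    ring
  rw [Finset.sum_apply]
  simp only [Pi.smul_apply, smul_eq_mul]
  rw [split, expand_filter, expand_m, split, hdp, hdq, hu2, hu1]
  simp only [Pi.smul_apply, smul_eq_mul]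
  linear_combination -(Pi.single p (1 : ℤ) : Fin n → ℤ) j * na
    - (Pi.single q (1 : ℤ) : Fin n → ℤ) j * nb
end

section
/- Let n ≥ 1 be an integer and let S be the set of vectors (m_0, m_1, …, m_{n-1}) in (ℤ_{≥0})^n satisfying Σ_{i=0}^{n-1} m_i = n and Σ_{i=0}^{n-1} i·m_i ≡ 0 (mod n). Then every vector m ∈ (ℤ_{≥0})^n with Σ_{i=0}^{n-1} m_i = 2n and n ∣ Σ_{i=0}^{n-1} i·m_i can be written as m = s_1 + s_2 with s_1, s_2 ∈ S. -/
/-- A vector `k` of multiplicities, of total size at least `2 * n - 1`, attached to integer weights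
`a` dominates a vector of total size `n` whose weighted sum is divisible by `n`. -/
theorem Int.exists_le_sum_eq_dvd_sum_mul {ι : Type*} [Fintype ι] (n : ℕ) (a : ι → ℤ) (k : ι → ℕ)
    (hk : 2 * n - 1 ≤ ∑ i, k i) :
    ∃ l ≤ k, ∑ i, l i = n ∧ (n : ℤ) ∣ ∑ i, a i * l i := by
  classical
  obtain ⟨t, -, htn, hdvd⟩ := Int.erdos_ginzburg_ziv (n := n)
    (s := (Finset.univ : Finset (Σ i, Fin (k i)))) (fun x ↦ a x.1) (by simpa using hk)
  refine ⟨fun i ↦ (t.filter (·.1 = i)).card, fun i ↦ ?_, ?_, ?_⟩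
  · calc (t.filter (·.1 = i)).card
        ≤ (Finset.univ.map (Function.Embedding.sigmaMk (β := fun i ↦ Fin (k i)) i)).card := by
          refine Finset.card_le_card fun x hx ↦ ?_
          obtain ⟨j, y⟩ := x
          obtain rfl : j = i := (Finset.mem_filter.1 hx).2
          simp
      _ = k i := by simp
  · rw [← htn, Finset.card_eq_sum_card_fiberwise (t := Finset.univ) (f := Sigma.fst) (by simp)]
  · convert hdvd using 1
    rw [← Finset.sum_fiberwise t Sigma.fst]
    refine Finset.sum_congr rfl fun i _ ↦ ?_
    rw [Finset.sum_congr rfl fun x hx ↦ congrArg a (Finset.mem_filter.1 hx).2]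
    simp [mul_comm]


/-- Every nonnegative integer vector `m ∈ ℤⁿ` with coordinate sum `2n` and
`n ∣ Σ i·mᵢ` is a sum of two elements of the set `S` of nonnegative vectors with
coordinate sum `n` and weighted sum `≡ 0 (mod n)`. -/
theorem degree_two_splits (n : ℕ) (hn : 1 ≤ n)
    (S : Set (Fin n → ℤ))
    (hS : S = {m : Fin n → ℤ | (∀ i, 0 ≤ m i) ∧ (∑ i, m i) = (n : ℤ) ∧
      (n : ℤ) ∣ ∑ i : Fin n, (i : ℤ) * m i})
    (m : Fin n → ℤ)
    (hm0 : ∀ i, 0 ≤ m i)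
    (hm1 : (∑ i, m i) = 2 * (n : ℤ))
    (hm2 : (n : ℤ) ∣ ∑ i : Fin n, (i : ℤ) * m i) :
    ∃ s₁ ∈ S, ∃ s₂ ∈ S, m = s₁ + s₂ := by
  subst hS
  lift m to Fin n → ℕ using hm0
  obtain ⟨l, hle, hsum, hdvd⟩ := Int.exists_le_sum_eq_dvd_sum_mul n (fun i : Fin n ↦ (i : ℤ)) m
    (by zify at hm1 ⊢; omega)
  have hsum' : ∑ i, (l i : ℤ) = n := by exact_mod_cast hsum
  refine ⟨fun i ↦ l i, ⟨fun i ↦ by positivity, hsum', hdvd⟩,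
    fun i ↦ m i - l i, ⟨fun i ↦ sub_nonneg.2 (by exact_mod_cast hle i), ?_, ?_⟩, ?_⟩
  · rw [Finset.sum_sub_distrib, hsum', hm1]
    ring
  · simp only [mul_sub, Finset.sum_sub_distrib]
    exact dvd_sub hm2 hdvd
  · ext i
    simp
end

section
/- Let n ≥ 1 be an integer and let S be the set of vectors (m_0, m_1, …, m_{n-1}) in (ℤ_{≥0})^n satisfying Σ_{i=0}^{n-1} m_i = n and Σ_{i=0}^{n-1} i·m_i ≡ 0 (mod n). Let A be the ℂ-subalgebra of the multivariate polynomial ring ℂ[X_0, X_1, …, X_{n-1}] generated by the monomials X_0^{m_0}·X_1^{m_1}⋯X_{n-1}^{m_{n-1}} with (m_0, …, m_{n-1}) ∈ S. Then A is an integrally closed domain, i.e., A is integrally closed in its field of fractions. -/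
open MvPolynomial

/-- The Erdős–Ginzburg–Ziv theorem for multisets with labels in `ZMod n`. -/
theorem Multiset.exists_le_card_eq_sum_map_eq_zero {ι : Type*} {n : ℕ} (a : ι → ZMod n)
    (s : Multiset ι) (hs : 2 * n - 1 ≤ s.card) :
    ∃ t ≤ s, t.card = n ∧ (t.map a).sum = 0 := by
  classical
  obtain ⟨t, hts, ht, hsum⟩ :=
    ZMod.erdos_ginzburg_ziv (s := s.toEnumFinset) (fun p ↦ a p.1) (by simpa using hs)
  exact ⟨t.1.map Prod.fst, Multiset.map_fst_le_of_subset_toEnumFinset hts, by simpa using ht,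
    by rwa [Multiset.map_map]⟩

/-- Zero-sum multisets whose cardinality is a multiple of `n` decompose into zero-sum multisets
of cardinality exactly `n`. -/
theorem Multiset.mem_closure_card_eq_sum_map_eq_zero {ι : Type*} {n : ℕ}
    (a : ι → ZMod n) (s : Multiset ι) (hcard : n ∣ s.card) (hsum : (s.map a).sum = 0) :
    s ∈ AddSubmonoid.closure {t : Multiset ι | t.card = n ∧ (t.map a).sum = 0} := by
  obtain ⟨k, hk⟩ := hcard
  induction k generalizing s with
  | zero =>
    rw [mul_zero, Multiset.card_eq_zero] at hk
    exact hk ▸ zero_mem _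
  | succ k ih =>
    rcases Nat.eq_zero_or_pos k with rfl | hpos
    · exact AddSubmonoid.subset_closure ⟨by simpa using hk, hsum⟩
    · obtain ⟨t, hts, htcard, htsum⟩ :=
        Multiset.exists_le_card_eq_sum_map_eq_zero a s (by rw [hk]; nlinarith [Nat.sub_le (2 * n) 1])
      obtain ⟨u, rfl⟩ := Multiset.le_iff_exists_add.mp hts
      rw [Multiset.card_add, htcard, mul_add, mul_one, add_comm, add_right_cancel_iff] at hk
      rw [Multiset.map_add, Multiset.sum_add, htsum, zero_add] at hsum
      exact add_mem (AddSubmonoid.subset_closure ⟨htcard, htsum⟩) (ih u hsum hk)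

/-- A subalgebra of an integrally closed domain which contains every quotient of its elements
that exists in the ambient ring is integrally closed. -/
theorem Subalgebra.isIntegrallyClosed_of_mul_mem {R B : Type*} [CommRing R] [CommRing B]
    [IsDomain B] [IsIntegrallyClosed B] [Algebra R B] (A : Subalgebra R B)
    (h : ∀ b ∈ A, ∀ c, b ≠ 0 → b * c ∈ A → c ∈ A) : IsIntegrallyClosed A := by
  have hinj : Function.Injective (algebraMap A (FractionRing B)) := by
    rw [IsScalarTower.algebraMap_eq A B (FractionRing B)]
    exact (IsFractionRing.injective B (FractionRing B)).comp Subtype.val_injective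
  let f : FractionRing A →ₐ[A] FractionRing B :=
    IsFractionRing.liftAlgHom (g := Algebra.ofId A (FractionRing B)) hinj
  refine (isIntegrallyClosed_iff (FractionRing A)).mpr fun {x} hx ↦ ?_
  obtain ⟨c, hc⟩ := IsIntegrallyClosed.isIntegral_iff.mp ((hx.map f).tower_top (A := B))
  obtain ⟨a, b, hb, rfl⟩ := IsFractionRing.div_surjective (A := A) x
  have hb0 : (b : B) ≠ 0 := fun h0 ↦ nonZeroDivisors.ne_zero hb (Subtype.ext h0)
  have hbc : (b : B) * c = a := by
    apply IsFractionRing.injective B (FractionRing B)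
    have hbK : algebraMap B (FractionRing B) b ≠ 0 := by
      simpa using hb0
    rw [map_mul, hc, map_div₀, AlgHom.commutes, AlgHom.commutes,
      IsScalarTower.algebraMap_apply A B (FractionRing B),
      IsScalarTower.algebraMap_apply A B (FractionRing B)]
    exact mul_div_cancel₀ _ hbK
  have hcA : c ∈ A := h b b.2 c hb0 (hbc ▸ a.2)
  refine ⟨⟨c, hcA⟩, f.toRingHom.injective ?_⟩
  change f _ = f _
  rw [AlgHom.commutes, ← hc]
  rfl

/-- A polynomial with a nonzero multiple of weighted degree `0` by a polynomial of weighted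
degree `0` itself has weighted degree `0`. -/
theorem MvPolynomial.IsWeightedHomogeneous.of_mul_zero {σ R M : Type*} [CommRing R] [IsDomain R]
    [AddCommMonoid M] {w : σ → M} {b c : MvPolynomial σ R} (hb : IsWeightedHomogeneous w b 0)
    (hb0 : b ≠ 0) (hbc : IsWeightedHomogeneous w (b * c) 0) : IsWeightedHomogeneous w c 0 := by
  classical
  let _ := weightedGradedAlgebra R w
  have key := DirectSum.coe_decompose_mul_of_left_mem_zero (j := (0 : M))
    (weightedHomogeneousSubmodule R w) (a := b) (b := c) hb
  rw [DirectSum.decompose_of_mem_same _ hbc] at key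
  rw [mul_left_cancel₀ hb0 key]
  exact (DirectSum.decompose (weightedHomogeneousSubmodule R w) c 0).2

theorem Finsupp.sum_map_toMultiset {σ M : Type*} [AddCommMonoid M] (w : σ → M) (m : σ →₀ ℕ) :
    (m.toMultiset.map w).sum = Finsupp.weight w m := by
  induction m using Finsupp.induction_linear with
  | zero => simp
  | add f g hf hg => simp [hf, hg]
  | single i k => simp [Finsupp.weight_single, Multiset.map_nsmul, Multiset.sum_nsmul]

theorem MvPolynomial.prod_map_X_toMultiset {σ R : Type*} [CommSemiring R] (m : σ →₀ ℕ) :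
    (m.toMultiset.map (X : σ → MvPolynomial σ R)).prod = monomial m 1 := by
  rw [monic_monomial_eq, Finsupp.toMultiset_map, Finsupp.prod_toMultiset,
    Finsupp.prod_mapDomain_index (by simp) (by simp [pow_add])]

/-- The subalgebra generated by the monomials of degree `n` with zero label sum in `ZMod n`
consists of the polynomials of degree zero for the induced `ZMod n × ZMod n`-grading. -/
theorem MvPolynomial.mem_adjoin_monomial_iff_isWeightedHomogeneous {σ R : Type*} [CommRing R]
    {n : ℕ} (a : σ → ZMod n) (p : MvPolynomial σ R) :
    p ∈ Algebra.adjoin R {p : MvPolynomial σ R | ∃ m : σ →₀ ℕ,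
        m.degree = n ∧ m.weight a = 0 ∧ p = monomial m 1} ↔
      IsWeightedHomogeneous (fun i ↦ ((1 : ZMod n), a i)) p 0 := by
  have hweight (m : σ →₀ ℕ) :
      m.weight (fun i ↦ ((1 : ZMod n), a i)) = ((m.degree : ZMod n), m.weight a) := by
    induction m using Finsupp.induction_linear with
    | zero => simp [← Prod.zero_eq_mk]
    | add f g hf hg => simp [hf, hg]
    | single i k => simp [Finsupp.weight_single]
  constructor
  · intro hp
    induction hp using Algebra.adjoin_induction with
    | mem p hp =>
      obtain ⟨m, hdeg, hsum, rfl⟩ := hp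
      exact isWeightedHomogeneous_monomial _ _ _ (by simp [hweight, hdeg, hsum])
    | algebraMap r => exact isWeightedHomogeneous_C _ r
    | add p q _ _ hp hq => exact hp.add hq
    | mul p q _ _ hp hq => simpa using hp.mul hq
  · intro hp
    rw [p.as_sum]
    refine sum_mem fun m hm ↦ ?_
    have hm0 := hp (mem_support_iff.mp hm)
    rw [hweight, Prod.mk_eq_zero, ZMod.natCast_eq_zero_iff] at hm0
    rw [← mul_one (coeff m p), ← smul_eq_mul, ← smul_monomial]
    refine Subalgebra.smul_mem _ ?_ _
    rw [← prod_map_X_toMultiset]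
    have hmem := Multiset.mem_closure_card_eq_sum_map_eq_zero a m.toMultiset
      (by simpa [Finsupp.card_toMultiset, Finsupp.degree_apply, Finsupp.sum] using hm0.1)
      (by rw [Finsupp.sum_map_toMultiset, hm0.2])
    generalize m.toMultiset = s at hmem
    induction hmem using AddSubmonoid.closure_induction with
    | mem t ht =>
      classical
      refine Algebra.subset_adjoin ⟨Multiset.toFinsupp t, ?_, ?_, ?_⟩
      · rw [← ht.1]
        conv_rhs => rw [← Multiset.toFinsupp_toMultiset t, Finsupp.card_toMultiset]
        simp [Finsupp.degree_apply, Finsupp.sum]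
      · rw [← Finsupp.sum_map_toMultiset, Multiset.toFinsupp_toMultiset, ht.2]
      · rw [← prod_map_X_toMultiset, Multiset.toFinsupp_toMultiset]
    | zero => simp
    | add s t _ _ hs ht => simpa using mul_mem hs ht

/-- The `ℂ`-subalgebra of `ℂ[X_0, …, X_{n-1}]` generated by the monomials
`X_0^{m_0}⋯X_{n-1}^{m_{n-1}}` with `Σ mᵢ = n` and `Σ i·mᵢ ≡ 0 (mod n)` is an integrally
closed domain. -/
theorem subalgebra_generated_by_invariant_monomials_is_integrally_closed
    (n : ℕ) (hn : 1 ≤ n)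
    (A : Subalgebra ℂ (MvPolynomial (Fin n) ℂ))
    (hA : A = Algebra.adjoin ℂ
      {p : MvPolynomial (Fin n) ℂ | ∃ m : Fin n → ℕ,
        (∑ i, m i) = n ∧ (n ∣ ∑ i : Fin n, (i : ℕ) * m i) ∧
        p = ∏ i : Fin n, (X i) ^ (m i)}) :
    IsDomain A ∧ IsIntegrallyClosed A := by
  refine ⟨inferInstance, A.isIntegrallyClosed_of_mul_mem ?_⟩
  have hset : {p : MvPolynomial (Fin n) ℂ | ∃ m : Fin n → ℕ,
        (∑ i, m i) = n ∧ (n ∣ ∑ i : Fin n, (i : ℕ) * m i) ∧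
        p = ∏ i : Fin n, (X i) ^ (m i)} =
      {p | ∃ m : Fin n →₀ ℕ, m.degree = n ∧ m.weight (fun i : Fin n ↦ ((i : ℕ) : ZMod n)) = 0 ∧
        p = monomial m 1} := by
    ext p
    refine Finsupp.equivFunOnFinite.symm.exists_congr fun m ↦ ?_
    rw [Finsupp.degree_eq_sum, Finsupp.weight_eq_sum, monic_monomial_eq,
      Finsupp.prod_fintype _ _ (by simp), ← ZMod.natCast_eq_zero_iff]
    simp [mul_comm]
  have hmem (p : MvPolynomial (Fin n) ℂ) : p ∈ A ↔
      IsWeightedHomogeneous (fun i : Fin n ↦ ((1 : ZMod n), ((i : ℕ) : ZMod n))) p 0 := by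
    rw [hA, hset, mem_adjoin_monomial_iff_isWeightedHomogeneous]
  intro b hb c hb0 hbc
  rw [hmem] at hb hbc ⊢
  exact hb.of_mul_zero hb0 hbc
end
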